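/- Let A be a real n×n matrix with positive diagonal entries, and write A = A_d + A_a⁺ + A_a⁻, where A_d is the diagonal part, A_a⁺ the positive off-diagonal part, and A_a⁻ the nonpositive off-diagonal part of A. Suppose A_a⁻ admits a decomposition A_a⁻ = A^z + A^s with A^z ≤ 0 and A^s ≤ 0 entrywise (both with zero diagonal) such that: (i) A_d + A^z is a nonsingular M-matrix; (ii) A_a⁺ ≤ A^z·A_d⁻¹·A^s entrywise; (iii) there exists a nonzero vector e ≥ 0 with Ae ≥ 0 such that A^z or A^s connects N⁰(Ae) with N⁺(Ae). Then A is a product of two nonsingular M-matrices; in particular A is invertible and A⁻¹ ≥ 0 entrywise. -/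

import Mathlib

/-- A nonsingular M-matrix: a Z-matrix (nonpositive off-diagonal entries) that is
invertible with entrywise nonnegative inverse. -/
def IsNonsingularMMatrix {n : ℕ} (A : Matrix (Fin n) (Fin n) ℝ) : Prop :=
  (∀ i j, i ≠ j → A i j ≤ 0) ∧ IsUnit A ∧ ∀ i j, 0 ≤ A⁻¹ i j

/-- `B` connects `N1` with `N2`: from every index in `N1` there is a directed path,
along nonzero entries of `B`, ending at some index of `N2`. -/
def Connects {n : ℕ} (B : Matrix (Fin n) (Fin n) ℝ) (N1 N2 : Set (Fin n)) : Prop :=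
  ∀ i0 ∈ N1, ∃ r : ℕ, 1 ≤ r ∧ ∃ p : Fin (r + 1) → Fin n,
    p 0 = i0 ∧ p (Fin.last r) ∈ N2 ∧ ∀ k : Fin r, B (p k.castSucc) (p k.succ) ≠ 0

/-- The set of indices where the vector `v` vanishes. -/
def Nzero {n : ℕ} (v : Fin n → ℝ) : Set (Fin n) := {i | v i = 0}

/-- The set of indices where the vector `v` is positive. -/
def Nplus {n : ℕ} (v : Fin n → ℝ) : Set (Fin n) := {i | 0 < v i}

/-- The diagonal part `A_d` of a square matrix. -/
noncomputable def diagPart {n : ℕ} (A : Matrix (Fin n) (Fin n) ℝ) :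
    Matrix (Fin n) (Fin n) ℝ :=
  Matrix.diagonal fun i => A i i

/-- The positive off-diagonal part `A_a⁺` of a square matrix. -/
noncomputable def offPos {n : ℕ} (A : Matrix (Fin n) (Fin n) ℝ) :
    Matrix (Fin n) (Fin n) ℝ :=
  fun i j => if i ≠ j ∧ 0 < A i j then A i j else 0

/-- The nonpositive off-diagonal part `A_a⁻` of a square matrix. -/
noncomputable def offNeg {n : ℕ} (A : Matrix (Fin n) (Fin n) ℝ) :
    Matrix (Fin n) (Fin n) ℝ :=
  fun i j => if i ≠ j ∧ A i j < 0 then A i j else 0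

/-- A set closed under the edges of `B` that meets `N1` also meets `N2`. -/
theorem Connects.exists_mem_of_closed {n : ℕ} {B : Matrix (Fin n) (Fin n) ℝ}
    {N1 N2 : Set (Fin n)} (h : Connects B N1 N2) {S : Set (Fin n)}
    (hS : ∀ i ∈ S, ∀ j, B i j ≠ 0 → j ∈ S) {i : Fin n} (hi : i ∈ N1) (hiS : i ∈ S) :
    ∃ j ∈ S, j ∈ N2 := by
  obtain ⟨r, -, p, hp0, hpr, hp⟩ := h i hi
  have hmem : ∀ k : Fin (r + 1), p k ∈ S := by
    intro k
    induction k using Fin.induction with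
    | zero => rwa [hp0]
    | succ k ih => exact hS _ ih _ (hp k)
  exact ⟨_, hmem _, hpr⟩

theorem Connects.mono {n : ℕ} {B C : Matrix (Fin n) (Fin n) ℝ} {N1 N2 N1' N2' : Set (Fin n)}
    (h : Connects B N1 N2) (hBC : ∀ i j, B i j ≠ 0 → C i j ≠ 0) (h1 : N1' ⊆ N1)
    (h2 : N2 ⊆ N2') : Connects C N1' N2' := by
  intro i hi
  obtain ⟨r, hr, p, hp0, hpr, hp⟩ := h i (h1 hi)
  exact ⟨r, hr, p, hp0, h2 hpr, fun k => hBC _ _ (hp k)⟩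

/-- If `B` is a Z-matrix, `x ≥ 0`, `x i = 0` and `(B x) i ≥ 0`, then `(B x) i = 0` and `x`
vanishes at all `B`-successors of `i`. -/
theorem zMatrix_mulVec_eq_zero {n : ℕ} {B : Matrix (Fin n) (Fin n) ℝ}
    (hB : ∀ i j, i ≠ j → B i j ≤ 0) {x : Fin n → ℝ} (hx : ∀ i, 0 ≤ x i) {i : Fin n}
    (hxi : x i = 0) (hBx : 0 ≤ B.mulVec x i) :
    B.mulVec x i = 0 ∧ ∀ j, B i j ≠ 0 → x j = 0 := by
  have hterm : ∀ j ∈ Finset.univ, B i j * x j ≤ 0 := by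
    intro j _
    by_cases hij : i = j
    · subst hij
      simp [hxi]
    · exact mul_nonpos_of_nonpos_of_nonneg (hB i j hij) (hx j)
  have hsum : ∑ j, B i j * x j = 0 := le_antisymm (Finset.sum_nonpos hterm) hBx
  refine ⟨hsum, fun j hj => ?_⟩
  have := (Finset.sum_eq_zero_iff_of_nonpos hterm).1 hsum j (Finset.mem_univ j)
  exact (mul_eq_zero.1 this).resolve_left hj

/-- A matrix `B` such that `B v ≥ 0` implies `v ≥ 0` is invertible with nonnegative inverse. -/
theorem isUnit_and_inv_nonneg_of_monotone {n : ℕ} {B : Matrix (Fin n) (Fin n) ℝ}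
    (hB : ∀ v : Fin n → ℝ, (∀ i, 0 ≤ B.mulVec v i) → ∀ i, 0 ≤ v i) :
    IsUnit B ∧ ∀ i j, 0 ≤ B⁻¹ i j := by
  have hunit : IsUnit B := by
    rw [← Matrix.mulVec_injective_iff_isUnit]
    intro v w hvw
    have hvw' : B.mulVec v = B.mulVec w := hvw
    funext i
    have h1 := hB (v - w) (fun i => by simp [Matrix.mulVec_sub, hvw']) i
    have h2 := hB (w - v) (fun i => by simp [Matrix.mulVec_sub, hvw']) i
    simp only [Pi.sub_apply] at h1 h2
    linarith
  refine ⟨hunit, fun i j => ?_⟩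
  refine hB (fun k => B⁻¹ k j) (fun k => ?_) i
  have h : B.mulVec (fun k => B⁻¹ k j) k = (B * B⁻¹) k j := rfl
  rw [h, Matrix.mul_nonsing_inv _ ((Matrix.isUnit_iff_isUnit_det B).1 hunit), Matrix.one_apply]
  split_ifs <;> norm_num

/-- A Z-matrix `B` is a nonsingular M-matrix as soon as there is `e ≥ 0` with `B e ≥ 0` such that
`B` connects `N⁰(Be)` with `N⁺(Be)`. -/
theorem isNonsingularMMatrix_of_connects {n : ℕ} {B : Matrix (Fin n) (Fin n) ℝ}
    (hB : ∀ i j, i ≠ j → B i j ≤ 0) {e : Fin n → ℝ} (he : ∀ i, 0 ≤ e i)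
    (hBe : ∀ i, 0 ≤ B.mulVec e i)
    (hconn : Connects B (Nzero (B.mulVec e)) (Nplus (B.mulVec e))) :
    IsNonsingularMMatrix B := by
  have hepos : ∀ i, 0 < e i := by
    intro i
    refine (he i).lt_of_ne' fun hi => ?_
    obtain ⟨j, hj, hjpos⟩ := hconn.exists_mem_of_closed (S := {i | e i = 0})
      (fun i hi => (zMatrix_mulVec_eq_zero hB he hi (hBe i)).2)
      (zMatrix_mulVec_eq_zero hB he hi (hBe i)).1 hi
    exact (ne_of_gt hjpos) (zMatrix_mulVec_eq_zero hB he hj (hBe j)).1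
  refine ⟨hB, isUnit_and_inv_nonneg_of_monotone fun v hv => ?_⟩
  by_contra! hneg
  obtain ⟨k, hk⟩ := hneg
  obtain ⟨i, -, hmin⟩ := Finset.exists_min_image Finset.univ (fun i => v i / e i)
    ⟨k, Finset.mem_univ k⟩
  set t := v i / e i with ht
  have htneg : t < 0 := (hmin k (Finset.mem_univ k)).trans_lt (div_neg_of_neg_of_pos hk (hepos k))
  have hw : ∀ j, 0 ≤ (v - t • e) j := by
    intro j
    have := (le_div_iff₀ (hepos j)).1 (hmin j (Finset.mem_univ j))
    simpa using this
  have hwi : (v - t • e) i = 0 := by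
    simp [ht, div_mul_cancel₀ _ (hepos i).ne']
  have hBw : ∀ j, B.mulVec (v - t • e) j = B.mulVec v j + -t * B.mulVec e j := by
    intro j
    rw [Matrix.mulVec_sub, Matrix.mulVec_smul, Pi.sub_apply, Pi.smul_apply, smul_eq_mul, neg_mul,
      ← sub_eq_add_neg]
  have hBw0 : ∀ j, 0 ≤ B.mulVec (v - t • e) j := by
    intro j
    rw [hBw]
    exact add_nonneg (hv j) (mul_nonneg (by linarith) (hBe j))
  have hzero : ∀ j, (v - t • e) j = 0 → B.mulVec e j = 0 := by
    intro j hj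
    have h0 := (zMatrix_mulVec_eq_zero hB hw hj (hBw0 j)).1
    rw [hBw] at h0
    have h1 := hv j
    have h2 := hBe j
    nlinarith [mul_nonneg (neg_nonneg.2 htneg.le) h2]
  obtain ⟨j, hj, hjpos⟩ := hconn.exists_mem_of_closed (S := {j | (v - t • e) j = 0})
    (fun i hi => (zMatrix_mulVec_eq_zero hB hw hi (hBw0 i)).2) (hzero i hwi) hwi
  exact (ne_of_gt hjpos) (hzero j hj)

theorem diagPart_add_offPos_add_offNeg {n : ℕ} (A : Matrix (Fin n) (Fin n) ℝ) :
    diagPart A + offPos A + offNeg A = A := by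
  ext i j
  by_cases hij : i = j
  · subst hij
    simp [diagPart, offPos, offNeg]
  · rcases lt_trichotomy (A i j) 0 with h | h | h
    · simp [diagPart, offPos, offNeg, hij, h, h.le]
    · simp [diagPart, offPos, offNeg, hij, h]
    · simp [diagPart, offPos, offNeg, hij, h, h.le]

/-- With `D = A_d`, `M = D + Aᶻ` and `R = Aᶻ D⁻¹ Aˢ - A_a⁺`, one has
`M⁻¹ A = 1 + D⁻¹ Aˢ - M⁻¹ R`. -/
theorem inv_diagPart_add_mul_self {n : ℕ} {A Az As : Matrix (Fin n) (Fin n) ℝ}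
    (hD : IsUnit (diagPart A)) (hdecomp : Az + As = offNeg A) (hM : IsUnit (diagPart A + Az)) :
    (diagPart A + Az)⁻¹ * A = 1 + (diagPart A)⁻¹ * As -
      (diagPart A + Az)⁻¹ * (Az * (diagPart A)⁻¹ * As - offPos A) := by
  rw [Matrix.isUnit_iff_isUnit_det] at hD hM
  have hA : A = (diagPart A + Az) * (1 + (diagPart A)⁻¹ * As) -
      (Az * (diagPart A)⁻¹ * As - offPos A) := by
    have h := diagPart_add_offPos_add_offNeg A
    rw [← hdecomp] at h
    rw [add_mul, mul_add, mul_add, mul_one, mul_one, Matrix.mul_nonsing_inv_cancel_left _ _ hD,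
      ← mul_assoc]
    nth_rewrite 1 [← h]
    abel
  nth_rewrite 2 [hA]
  rw [mul_sub, Matrix.nonsing_inv_mul_cancel_left _ _ hM]

/-- Lorenz's condition: if `A` has positive diagonal entries and
`A_a⁻ = A^z + A^s` with `A^z, A^s ≤ 0` (zero diagonals) such that `A_d + A^z` is a
nonsingular M-matrix, `A_a⁺ ≤ A^z A_d⁻¹ A^s`, and `A^z` or `A^s` connects `N⁰(Ae)`
with `N⁺(Ae)` for some nonzero `e ≥ 0` with `Ae ≥ 0`, then `A` is a product of two
nonsingular M-matrices; in particular `A⁻¹ ≥ 0`. -/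
theorem stmt6 {n : ℕ} (A Az As : Matrix (Fin n) (Fin n) ℝ)
    (hdiag : ∀ i, 0 < A i i)
    (hAz : ∀ i j, Az i j ≤ 0) (hAs : ∀ i j, As i j ≤ 0)
    (hAzd : ∀ i, Az i i = 0) (hAsd : ∀ i, As i i = 0)
    (hdecomp : Az + As = offNeg A)
    (hM : IsNonsingularMMatrix (diagPart A + Az))
    (hprod : ∀ i j, offPos A i j ≤ (Az * (diagPart A)⁻¹ * As) i j)
    (hconn : ∃ e : Fin n → ℝ, e ≠ 0 ∧ (∀ i, 0 ≤ e i) ∧ (∀ i, 0 ≤ A.mulVec e i) ∧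
      (Connects Az (Nzero (A.mulVec e)) (Nplus (A.mulVec e)) ∨
        Connects As (Nzero (A.mulVec e)) (Nplus (A.mulVec e)))) :
    (∃ M1 M2 : Matrix (Fin n) (Fin n) ℝ,
        IsNonsingularMMatrix M1 ∧ IsNonsingularMMatrix M2 ∧ A = M1 * M2) ∧
      IsUnit A ∧ ∀ i j, 0 ≤ A⁻¹ i j := by
  have hDunit : IsUnit (diagPart A) := by
    rw [Matrix.isUnit_iff_isUnit_det, diagPart, Matrix.det_diagonal, isUnit_iff_ne_zero]
    exact Finset.prod_ne_zero_iff.2 fun i _ => (hdiag i).ne'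
  have hDinv : (diagPart A)⁻¹ = Matrix.diagonal fun i => (A i i)⁻¹ := by
    refine Matrix.inv_eq_right_inv ?_
    rw [diagPart, Matrix.diagonal_mul_diagonal, ← Matrix.diagonal_one]
    congr 1
    funext i
    exact mul_inv_cancel₀ (hdiag i).ne'
  obtain ⟨hMZ, hMunit, hMinv⟩ := hM
  have hM2 := inv_diagPart_add_mul_self hDunit hdecomp hMunit
  have hMdet := (Matrix.isUnit_iff_isUnit_det _).1 hMunit
  set M := diagPart A + Az with hMdef
  have hfac : M * (M⁻¹ * A) = A := Matrix.mul_nonsing_inv_cancel_left _ _ hMdet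
  have hle : ∀ i j, i ≠ j → (M⁻¹ * A) i j ≤ (A i i)⁻¹ * As i j := by
    intro i j hij
    have hR : 0 ≤ (M⁻¹ * (Az * (diagPart A)⁻¹ * As - offPos A)) i j := by
      rw [Matrix.mul_apply]
      exact Finset.sum_nonneg fun k _ => mul_nonneg (hMinv i k) (sub_nonneg.2 (hprod k j))
    rw [hM2, Matrix.sub_apply, Matrix.add_apply, Matrix.one_apply_ne hij, hDinv,
      Matrix.diagonal_mul, ← hDinv]
    linarith
  have hZ : ∀ i j, i ≠ j → (M⁻¹ * A) i j ≤ 0 := fun i j hij =>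
    (hle i j hij).trans (mul_nonpos_of_nonneg_of_nonpos (inv_pos.2 (hdiag i)).le (hAs i j))
  obtain ⟨e, -, he, hAe, hconn⟩ := hconn
  have hMx : M.mulVec ((M⁻¹ * A).mulVec e) = A.mulVec e := by
    rw [Matrix.mulVec_mulVec, hfac]
  have hx : ∀ i, 0 ≤ (M⁻¹ * A).mulVec e i := by
    intro i
    rw [← Matrix.mulVec_mulVec]
    exact dotProduct_nonneg_of_nonneg (hMinv i) hAe
  have hzero : ∀ i, (M⁻¹ * A).mulVec e i = 0 →
      A.mulVec e i = 0 ∧ ∀ j, M i j ≠ 0 → (M⁻¹ * A).mulVec e j = 0 := by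
    intro i hi
    have h := zMatrix_mulVec_eq_zero hMZ hx hi (by rw [hMx]; exact hAe i)
    rwa [hMx] at h
  have hM2M : IsNonsingularMMatrix (M⁻¹ * A) := by
    refine isNonsingularMMatrix_of_connects hZ he hx ?_
    rcases hconn with hconn | hconn
    · intro i hi
      obtain ⟨j, hj, hjpos⟩ := hconn.exists_mem_of_closed
        (S := {i | (M⁻¹ * A).mulVec e i = 0})
        (fun i hi j hij => (hzero i hi).2 j (by
          have hne : i ≠ j := fun h => hij (h ▸ hAzd i)
          simpa [hMdef, diagPart, hne] using hij))
        (hzero i hi).1 hi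
      exact absurd (hzero j hj).1 (ne_of_gt hjpos)
    · refine hconn.mono (fun i j hij => ?_) (fun i hi => (hzero i hi).1)
        fun i hi => (hx i).lt_of_ne' fun h => (ne_of_gt hi) (hzero i h).1
      have hne : i ≠ j := fun h => hij (h ▸ hAsd i)
      exact ((hle i j hne).trans_lt (mul_neg_of_pos_of_neg (inv_pos.2 (hdiag i))
        ((hAs i j).lt_of_ne hij))).ne
  refine ⟨⟨M, M⁻¹ * A, ⟨hMZ, hMunit, hMinv⟩, hM2M, hfac.symm⟩, ?_, ?_⟩
  · rw [← hfac]
    exact hMunit.mul hM2M.2.1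
  · intro i j
    rw [← hfac, Matrix.mul_inv_rev, Matrix.mul_apply]
    exact Finset.sum_nonneg fun k _ => mul_nonneg (hM2M.2.2 i k) (hMinv k j)
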